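/- Let K ⊂ ℝ^{2n} be a convex polytope with 0 in its interior, facet unit outer normals n_1,…,n_N and oriented heights h_1,…,h_N > 0. For facet data (m_1,…,m_L; g_1,…,g_L) of a polytope in a symplectic vector space (V, ω), let M denote the set of pairs ((β_i)_{i=1}^L, σ) with σ a permutation of {1,…,L}, β_i ≥ 0, Σ β_i g_i = 1, Σ β_i m_i = 0, and Q(β,σ) := Σ_{1≤j<i≤L} β_{σ(i)} β_{σ(j)} ω(m_{σ(j)}, m_{σ(i)}) > 0, and let c := (1/2)·(sup_{(β,σ)∈M} Q(β,σ))^{-1} (the Haim–Kislev combinatorial expression for the Ekeland–Hofer–Zehnder capacity). Then, taking for K ×_L J_{2n}K the facet data ñ_i = (n_i,0), ñ_{N+i} = (0, J_{2n} n_i), h̃_i = h̃_{N+i} = h_i (i = 1,…,N) in (ℝ^{2n}×ℝ^{2n}, ω̃) with ω̃((q,p),(q′,p′)) = ⟨q,p′⟩ − ⟨q′,p⟩, one has c(K ×_L J_{2n}K) ≤ 2 c(K). -/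

import Mathlib

open scoped RealInnerProductSpace BigOperators

noncomputable section

/-- `ℝ^m` with the Euclidean inner product. -/
abbrev Es (m : ℕ) := EuclideanSpace ℝ (Fin m)

/-- Doubled facet data: the first copy `f` lives on indices `0,…,N-1`
and the second copy `g` on indices `N,…,2N-1`. -/
def dbl {N : ℕ} {α : Sort _} (f g : Fin N → α) (k : Fin (2 * N)) : α :=
  if hk : (k : ℕ) < N then f ⟨k, hk⟩ else g ⟨(k : ℕ) - N, by omega⟩

/-- The symplectic form on the Lagrangian product `ℝ^{2n} × ℝ^{2n}`:
`ω̃((q,p),(q′,p′)) = ⟪q, p′⟫ − ⟪q′, p⟫`. -/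
def omegaT {m : ℕ} (x y : Es m × Es m) : ℝ := ⟪x.1, y.2⟫ - ⟪y.1, x.2⟫

/-- The Haim–Kislev combinatorial expression for the Ekeland–Hofer–Zehnder capacity of a
convex polytope with facet unit outer normals `m i` and oriented heights `g i` in a
symplectic vector space `(V, ω)`:
`c = (1/2) ⬝ (sup over admissible (β,σ) with Q(β,σ) > 0 of Q(β,σ))⁻¹`, where
`Q(β,σ) = ∑_{j<i} β_{σ(i)} β_{σ(j)} ω(m_{σ(j)}, m_{σ(i)})` and admissibility means
`β i ≥ 0`, `∑ β i * g i = 1`, `∑ β i • m i = 0`. -/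
def combCap {V : Type _} [AddCommGroup V] [Module ℝ V] {L : ℕ}
    (ω : V → V → ℝ) (m : Fin L → V) (g : Fin L → ℝ) : ℝ :=
  (1 / 2 : ℝ) * (sSup {Q : ℝ | ∃ (β : Fin L → ℝ) (σ : Equiv.Perm (Fin L)),
      (∀ i, 0 ≤ β i) ∧ ∑ i, β i * g i = 1 ∧ ∑ i, β i • m i = 0 ∧
      0 < Q ∧ Q = ∑ i, ∑ j ∈ Finset.Iio i, β (σ i) * β (σ j) * ω (m (σ j)) (m (σ i))})⁻¹

/-- The set of positive values of `Q(β,σ)` over admissible pairs, whose supremum defines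
`combCap`. -/
def actionSet {V : Type _} [AddCommGroup V] [Module ℝ V] {L : ℕ}
    (ω : V → V → ℝ) (m : Fin L → V) (g : Fin L → ℝ) : Set ℝ :=
  {Q : ℝ | ∃ (β : Fin L → ℝ) (σ : Equiv.Perm (Fin L)),
      (∀ i, 0 ≤ β i) ∧ ∑ i, β i * g i = 1 ∧ ∑ i, β i • m i = 0 ∧
      0 < Q ∧ Q = ∑ i, ∑ j ∈ Finset.Iio i, β (σ i) * β (σ j) * ω (m (σ j)) (m (σ i))}

theorem combCap_eq {V : Type _} [AddCommGroup V] [Module ℝ V] {L : ℕ}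
    (ω : V → V → ℝ) (m : Fin L → V) (g : Fin L → ℝ) :
    combCap ω m g = (1 / 2 : ℝ) * (sSup (actionSet ω m g))⁻¹ := rfl

/-- A sum over pairs of increasing positions, rewritten as a sum over pairs of indices. -/
theorem sum_Iio_perm {L : ℕ} (σ : Equiv.Perm (Fin L)) (f : Fin L → Fin L → ℝ) :
    ∑ i, ∑ j ∈ Finset.Iio i, f (σ j) (σ i)
      = ∑ k, ∑ l, if σ.symm l < σ.symm k then f l k else 0 := by
  rw [← Equiv.sum_comp σ fun k => ∑ l, if σ.symm l < σ.symm k then f l k else 0]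
  refine Finset.sum_congr rfl fun i _ => ?_
  rw [← Equiv.sum_comp σ fun l => if σ.symm l < σ.symm (σ i) then f l (σ i) else 0]
  simp only [Equiv.symm_apply_apply]
  rw [← Finset.sum_filter]
  refine Finset.sum_congr ?_ fun _ _ => rfl
  ext j
  simp

/-- Any injective ranking of the indices is realised by a permutation. -/
theorem exists_perm_of_injective {L : ℕ} (p : Fin L → ℤ) (hp : Function.Injective p) :
    ∃ σ : Equiv.Perm (Fin L), ∀ k l, σ.symm l < σ.symm k ↔ p l < p k := by
  refine ⟨Tuple.sort p, fun k l => ?_⟩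
  have hmono : StrictMono (p ∘ Tuple.sort p) :=
    (Tuple.monotone_sort p).strictMono_of_injective (hp.comp (Tuple.sort p).injective)
  rw [← hmono.lt_iff_lt]
  simp

theorem bddAbove_actionSet {V : Type _} [AddCommGroup V] [Module ℝ V] {L : ℕ}
    (ω : V → V → ℝ) (m : Fin L → V) (g : Fin L → ℝ) (hg : ∀ i, 0 < g i) :
    BddAbove (actionSet ω m g) := by
  refine ⟨∑ k, ∑ l, (g k)⁻¹ * (g l)⁻¹ * |ω (m l) (m k)|, ?_⟩
  rintro Q ⟨β, σ, hβ, hsum, -, -, rfl⟩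
  have hle : ∀ i, β i ≤ (g i)⁻¹ := fun i => by
    rw [← one_div, le_div_iff₀ (hg i), ← hsum]
    exact Finset.single_le_sum (f := fun i => β i * g i)
      (fun j _ => mul_nonneg (hβ j) (hg j).le) (Finset.mem_univ i)
  rw [sum_Iio_perm σ fun l k => β k * β l * ω (m l) (m k)]
  refine Finset.sum_le_sum fun k _ => Finset.sum_le_sum fun l _ => ?_
  have hk := inv_nonneg.2 (hg k).le
  have hl := inv_nonneg.2 (hg l).le
  split_ifs
  · calc β k * β l * ω (m l) (m k) ≤ β k * β l * |ω (m l) (m k)| :=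
          mul_le_mul_of_nonneg_left (le_abs_self _) (mul_nonneg (hβ k) (hβ l))
      _ ≤ (g k)⁻¹ * (g l)⁻¹ * |ω (m l) (m k)| :=
          mul_le_mul_of_nonneg_right (mul_le_mul (hle k) (hle l) (hβ l) hk) (abs_nonneg _)
  · positivity

theorem dbl_castAdd {N : ℕ} {α : Sort _} (f g : Fin N → α) (i : Fin N) :
    dbl f g ⟨i, by omega⟩ = f i := by
  simp [dbl]

theorem dbl_natAdd {N : ℕ} {α : Sort _} (f g : Fin N → α) (i : Fin N) :
    dbl f g ⟨N + i, by omega⟩ = g i := by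
  simp [dbl]

theorem sum_dbl {N : ℕ} {M : Type*} [AddCommMonoid M] (F : Fin (2 * N) → M) :
    ∑ k, F k = ∑ i : Fin N, F ⟨i, by omega⟩ + ∑ i : Fin N, F ⟨N + i, by omega⟩ := by
  rw [← Equiv.sum_comp (finCongr (two_mul N).symm), Fin.sum_univ_add]
  rfl

/-- Half of each action value of the polytope is an action value of the Lagrangian product. -/
theorem half_mem_actionSet_dbl {d N : ℕ} (J : Es d →ₗ[ℝ] Es d)
    (ω₀ : Es d → Es d → ℝ) (hω : ∀ x y, ω₀ x y = -⟪x, J y⟫) (hself : ∀ x, ⟪x, J x⟫ = 0)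
    (hskew : ∀ x y, ⟪x, J y⟫ = -⟪y, J x⟫)
    (nv : Fin N → Es d) (h : Fin N → ℝ) {Q : ℝ} (hQ : Q ∈ actionSet ω₀ nv h) :
    Q / 2 ∈ actionSet omegaT
        (dbl (fun i => (nv i, (0 : Es d))) (fun i => ((0 : Es d), J (nv i))))
        (dbl h h) := by
  obtain ⟨β, σ, hβ, hsum, hzero, hpos, hQ⟩ := hQ
  set s : Fin N → ℤ := fun i => ((σ.symm i : ℕ) : ℤ) with hs
  have hsinj : ∀ {i j}, s i = s j → i = j := fun {i j} hij => by
    apply σ.symm.injective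
    apply Fin.ext
    simp only [hs] at hij
    exact_mod_cast hij
  set p : Fin (2 * N) → ℤ := dbl (fun i => -2 * s i) (fun i => -2 * s i - 1) with hp
  have hpinj : Function.Injective p := by
    intro a b hab
    simp only [hp, dbl] at hab
    split_ifs at hab with ha hb hb
    · have := congrArg Fin.val (hsinj (by omega : s ⟨a, ha⟩ = s ⟨b, hb⟩))
      exact Fin.ext this
    · omega
    · omega
    · have := congrArg Fin.val (hsinj (by omega : s ⟨a - N, _⟩ = s ⟨b - N, _⟩))
      simp only at this
      exact Fin.ext (by omega)
  obtain ⟨τ, hτ⟩ := exists_perm_of_injective p hpinj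
  set b : Fin (2 * N) → ℝ := dbl (fun i => β i / 2) (fun i => β i / 2) with hb
  refine ⟨b, τ, ?_, ?_, ?_, by linarith, ?_⟩
  · intro i
    simp only [hb, dbl]
    split_ifs <;> exact div_nonneg (hβ _) two_pos.le
  · simp only [hb, sum_dbl, dbl_castAdd, dbl_natAdd]
    rw [← Finset.sum_add_distrib, ← hsum]
    exact Finset.sum_congr rfl fun i _ => by ring
  · have h2 : ∑ i, (β i / 2) • nv i = 0 := by
      have : ∀ i, (β i / 2) • nv i = (2⁻¹ : ℝ) • (β i • nv i) := fun i => by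
        rw [smul_smul]; congr 1; ring
      simp only [this, ← Finset.smul_sum, hzero, smul_zero]
    have h3 : ∑ i, (β i / 2) • J (nv i) = 0 := by
      simp only [← map_smul, ← map_sum, h2, map_zero]
    simp only [hb, sum_dbl, dbl_castAdd, dbl_natAdd]
    ext1
    · simp [Prod.fst_sum, h2]
    · simp [Prod.snd_sum, h3]
  · rw [sum_Iio_perm σ fun l k => β k * β l * ω₀ (nv l) (nv k)] at hQ
    have hQ' := hQ
    rw [Finset.sum_comm] at hQ'
    rw [sum_Iio_perm τ fun l k => b k * b l * omegaT
      (dbl (fun i => (nv i, (0 : Es d))) (fun i => ((0 : Es d), J (nv i))) l)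
      (dbl (fun i => (nv i, (0 : Es d))) (fun i => ((0 : Es d), J (nv i))) k)]
    simp only [hτ, hp, hb, sum_dbl, dbl_castAdd, dbl_natAdd]
    simp only [omegaT, inner_zero_left, inner_zero_right, sub_zero, zero_sub, mul_zero, ite_self,
      Finset.sum_const_zero, zero_add, add_zero]
    have e1 : ∑ k, ∑ l, (if -2 * s l - 1 < -2 * s k then
        β k / 2 * (β l / 2) * -⟪nv k, J (nv l)⟫ else 0) = Q / 4 := by
      rw [hQ', Finset.sum_div]
      refine Finset.sum_congr rfl fun k _ => ?_
      rw [Finset.sum_div]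
      refine Finset.sum_congr rfl fun l _ => ?_
      rcases eq_or_ne k l with rfl | hkl
      · simp [hself]
      · have hne : s k ≠ s l := fun e => hkl (hsinj e)
        have hiff : -2 * s l - 1 < -2 * s k ↔ σ.symm k < σ.symm l := by
          rw [Fin.lt_def]; simp only [hs] at hne ⊢; omega
        simp only [hiff, hω]
        split_ifs <;> ring
    have e2 : ∑ k, ∑ l, (if -2 * s l < -2 * s k - 1 then
        β k / 2 * (β l / 2) * ⟪nv l, J (nv k)⟫ else 0) = Q / 4 := by
      rw [hQ', Finset.sum_div]
      refine Finset.sum_congr rfl fun k _ => ?_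
      rw [Finset.sum_div]
      refine Finset.sum_congr rfl fun l _ => ?_
      have hiff : -2 * s l < -2 * s k - 1 ↔ σ.symm k < σ.symm l := by
        rw [Fin.lt_def]; simp only [hs]; omega
      simp only [hiff, hω, hskew (nv l)]
      split_ifs <;> ring
    rw [e1, e2]
    ring

/-- The normals of a compact polytope with positive heights satisfy a linear relation with
strictly positive coefficients. -/
theorem exists_pos_relation {d N : ℕ} (nv : Fin N → Es d) (h : Fin N → ℝ)
    (hpos : ∀ i, 0 < h i) (hK : IsCompact {x : Es d | ∀ i, ⟪x, nv i⟫ ≤ h i}) :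
    ∃ γ : Fin N → ℝ, (∀ i, 0 < γ i) ∧ ∑ i, γ i • nv i = 0 := by
  set F : Es d → ℝ := fun x => ∑ i, Real.exp (⟪x, nv i⟫ * (N / h i)) with hF
  have hcont : Continuous F := by fun_prop
  have h0 : (0 : Es d) ∈ {x : Es d | ∀ i, ⟪x, nv i⟫ ≤ h i} := fun i => by
    simpa using (hpos i).le
  obtain ⟨x, -, hx⟩ := hK.exists_isMinOn ⟨0, h0⟩ hcont.continuousOn
  have hF0 : F 0 = N := by simp [hF]
  have hmin : ∀ y, F x ≤ F y := fun y => by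
    by_cases hy : ∀ i, ⟪y, nv i⟫ ≤ h i
    · exact hx hy
    · push Not at hy
      obtain ⟨i, hi⟩ := hy
      have h1 : (N : ℝ) ≤ ⟪y, nv i⟫ * (N / h i) := by
        have : (1 : ℝ) ≤ ⟪y, nv i⟫ / h i := by rw [le_div_iff₀ (hpos i)]; linarith
        calc (N : ℝ) = 1 * N := by ring
          _ ≤ ⟪y, nv i⟫ / h i * N := mul_le_mul_of_nonneg_right this (Nat.cast_nonneg N)
          _ = _ := by ring
      calc F x ≤ F 0 := hx h0
        _ = N := hF0
        _ ≤ Real.exp (⟪y, nv i⟫ * (N / h i)) := by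
            linarith [Real.add_one_le_exp (⟪y, nv i⟫ * (N / h i))]
        _ ≤ F y := Finset.single_le_sum (f := fun i => Real.exp (⟪y, nv i⟫ * (N / h i)))
            (fun j _ => (Real.exp_pos _).le) (Finset.mem_univ i)
  refine ⟨fun i => Real.exp (⟪x, nv i⟫ * (N / h i)) * (N / h i), fun i => ?_, ?_⟩
  · have : (0 : ℝ) < N := by exact_mod_cast i.pos
    have := hpos i
    positivity
  · refine ext_inner_left ℝ fun v => ?_
    have hder : HasDerivAt (fun t : ℝ => F (x + t • v))
        (∑ i, Real.exp (⟪x + (0 : ℝ) • v, nv i⟫ * (N / h i)) * (⟪v, nv i⟫ * (N / h i))) 0 := by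
      refine HasDerivAt.fun_sum fun i _ => ?_
      refine HasDerivAt.exp ?_
      refine HasDerivAt.mul_const ?_ _
      simp only [inner_add_left, real_inner_smul_left]
      simpa using ((hasDerivAt_id (0 : ℝ)).mul_const ⟪v, nv i⟫).const_add ⟪x, nv i⟫
    have hloc : IsLocalMin (fun t : ℝ => F (x + t • v)) 0 :=
      Filter.Eventually.of_forall fun t => by simpa using hmin (x + t • v)
    have hz := hloc.hasDerivAt_eq_zero hder
    rw [inner_sum, inner_zero_right, ← hz]
    refine Finset.sum_congr rfl fun i _ => ?_
    rw [real_inner_smul_right, zero_smul, add_zero]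
    ring

/-- A vector orthogonal to all the normals of a compact polytope vanishes. -/
theorem eq_zero_of_inner_normals_eq_zero {d N : ℕ} (nv : Fin N → Es d) (h : Fin N → ℝ)
    (hpos : ∀ i, 0 < h i) (hK : IsCompact {x : Es d | ∀ i, ⟪x, nv i⟫ ≤ h i})
    (x : Es d) (hx : ∀ i, ⟪x, nv i⟫ = 0) : x = 0 := by
  by_contra hne
  obtain ⟨R, hR⟩ := hK.isBounded.exists_norm_le
  have hn : 0 < ‖x‖ := norm_pos_iff.2 hne
  have hmem : ((|R| + 1) / ‖x‖) • x ∈ {x : Es d | ∀ i, ⟪x, nv i⟫ ≤ h i} := fun i => by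
    rw [real_inner_smul_left, hx i, mul_zero]
    exact (hpos i).le
  have := hR _ hmem
  rw [norm_smul, Real.norm_of_nonneg (by positivity), div_mul_cancel₀ _ hn.ne'] at this
  linarith [le_abs_self R]

/-- If a skew matrix has a nonzero entry, some ordering of the indices gives a positive sum over
increasing pairs. -/
theorem exists_perm_sum_pos {L : ℕ} (A : Fin L → Fin L → ℝ) (hA : ∀ k l, A k l = -A l k)
    {i j : Fin L} (hij : A i j ≠ 0) :
    ∃ σ : Equiv.Perm (Fin L), 0 < ∑ a, ∑ b ∈ Finset.Iio a, A (σ b) (σ a) := by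
  wlog hpos : 0 < A i j generalizing i j
  · refine this (i := j) (j := i) ?_ ?_
    · rw [hA]; exact neg_ne_zero.2 hij
    · rw [hA]
      have := lt_of_le_of_ne (not_lt.1 hpos) hij
      linarith
  have hne : i ≠ j := by
    rintro rfl
    linarith [hA i i]
  set T : (Fin L → ℤ) → ℝ := fun p => ∑ k, ∑ l, if p l < p k then A l k else 0 with hT
  have key : ∀ p : Fin L → ℤ, Function.Injective p → 0 < T p →
      ∃ σ : Equiv.Perm (Fin L), 0 < ∑ a, ∑ b ∈ Finset.Iio a, A (σ b) (σ a) := by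
    intro p hp hTp
    obtain ⟨σ, hσ⟩ := exists_perm_of_injective p hp
    refine ⟨σ, ?_⟩
    rw [sum_Iio_perm σ A]
    simpa only [hσ] using hTp
  set p : Fin L → ℤ := fun k => if k = i then -2 else if k = j then -1 else (k : ℕ) with hp
  set q : Fin L → ℤ := fun k => if k = i then 1 else if k = j then 2 else -((k : ℕ) : ℤ) with hq
  have hpinj : Function.Injective p := by
    intro a b hab
    simp only [hp] at hab
    grind
  have hqinj : Function.Injective q := by
    intro a b hab
    simp only [hq] at hab
    grind
  have hskew : ∑ k, ∑ l, A l k = 0 := by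
    have h1 : ∑ k, ∑ l, A l k = -∑ k, ∑ l, A l k := by
      conv_lhs => rw [Finset.sum_comm]
      simp only [← Finset.sum_neg_distrib]
      exact Finset.sum_congr rfl fun k _ => Finset.sum_congr rfl fun l _ => hA k l
    linarith
  have hsum : T p + T q = 2 * A i j := by
    have hterm : ∀ k l, ((if p l < p k then A l k else 0) + if q l < q k then A l k else 0)
        = A l k + ((if l = i then if k = j then A i j else 0 else 0)
          - if l = j then if k = i then A j i else 0 else 0) := by
      intro k l
      have hkk := hA k k
      have hkl := hA k l
      have hval : k ≠ l → ((k : ℕ) : ℤ) ≠ ((l : ℕ) : ℤ) := by omega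
      have hk0 : (0 : ℤ) ≤ ((k : ℕ) : ℤ) := by omega
      have hl0 : (0 : ℤ) ≤ ((l : ℕ) : ℤ) := by omega
      simp only [hp, hq]
      generalize ((k : ℕ) : ℤ) = a at *
      generalize ((l : ℕ) : ℤ) = b at *
      clear hT hpinj hqinj hskew key hp hq p q
      by_cases h1 : k = i <;> by_cases h2 : k = j <;> by_cases h3 : l = i <;>
        by_cases h4 : l = j <;> simp only [h1, h2, h3, h4, if_true, if_false] <;> grind
    simp only [hT, ← Finset.sum_add_distrib, hterm]
    simp only [Finset.sum_add_distrib, Finset.sum_sub_distrib, hskew]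
    simp only [if_true, Finset.sum_ite_eq', Finset.mem_univ]
    rw [hA j i]
    ring
  rcases lt_or_ge 0 (T p) with hTp | hTp
  · exact key p hpinj hTp
  · exact key q hqinj (by linarith)

theorem actionSet_nonempty {d N : ℕ} (hd : 0 < d) (J : Es d →ₗ[ℝ] Es d)
    (hJorth : ∀ x y, ⟪J x, J y⟫ = ⟪x, y⟫)
    (ω₀ : Es d → Es d → ℝ) (hω : ∀ x y, ω₀ x y = -⟪x, J y⟫)
    (hskew : ∀ x y, ⟪x, J y⟫ = -⟪y, J x⟫)
    (nv : Fin N → Es d) (hunit : ∀ i, ‖nv i‖ = 1)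
    (h : Fin N → ℝ) (hpos : ∀ i, 0 < h i)
    (hK : IsCompact {x : Es d | ∀ i, ⟪x, nv i⟫ ≤ h i}) :
    (actionSet ω₀ nv h).Nonempty := by
  obtain ⟨γ, hγ, hγ0⟩ := exists_pos_relation nv h hpos hK
  have hspan := eq_zero_of_inner_normals_eq_zero nv h hpos hK
  have hj : Nonempty (Fin N) := by
    by_contra hemp
    rw [not_nonempty_iff] at hemp
    have := hspan (EuclideanSpace.single ⟨0, hd⟩ 1) fun i => hemp.elim i
    simpa using congrArg norm this
  obtain ⟨j⟩ := hj
  obtain ⟨i, hi⟩ : ∃ i, ⟪J (nv j), nv i⟫ ≠ 0 := by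
    by_contra! hall
    have h1 := hspan _ hall
    have h2 := hJorth (nv j) (nv j)
    rw [h1, inner_zero_left, real_inner_self_eq_norm_sq, hunit j] at h2
    norm_num at h2
  set H := ∑ i, γ i * h i with hH
  have hHpos : 0 < H :=
    Finset.sum_pos (fun k _ => mul_pos (hγ k) (hpos k)) ⟨j, Finset.mem_univ j⟩
  have hβ : ∀ k, 0 < γ k / H := fun k => div_pos (hγ k) hHpos
  obtain ⟨σ, hσ⟩ := exists_perm_sum_pos
    (fun l k => γ k / H * (γ l / H) * ω₀ (nv l) (nv k))
    (fun k l => by simp only [hω, hskew (nv k)]; ring) (i := i) (j := j)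
    (by
      rw [hω, real_inner_comm]
      exact mul_ne_zero (mul_pos (hβ _) (hβ _)).ne' (neg_ne_zero.2 hi))
  refine ⟨_, fun k => γ k / H, σ, fun k => (hβ k).le, ?_, ?_, hσ, rfl⟩
  · rw [← div_self hHpos.ne']
    nth_rewrite 2 [hH]
    rw [Finset.sum_div]
    exact Finset.sum_congr rfl fun k _ => by ring
  · have : ∀ k, (γ k / H) • nv k = H⁻¹ • (γ k • nv k) := fun k => by
      rw [smul_smul]; congr 1; ring
    simp only [this, ← Finset.smul_sum, hγ0, smul_zero]

theorem cap_prod_JK_le_two_cap (n N : ℕ) (hn : 1 ≤ n)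
    (J : Es (2 * n) →ₗ[ℝ] Es (2 * n))
    (hJorth : ∀ x y : Es (2 * n), ⟪J x, J y⟫ = ⟪x, y⟫)
    (hJsq : ∀ x : Es (2 * n), J (J x) = -x)
    (ω₀ : Es (2 * n) → Es (2 * n) → ℝ)
    (hω : ∀ x y : Es (2 * n), ⟪x, y⟫ = ω₀ x (J y))
    (nv : Fin N → Es (2 * n)) (hunit : ∀ i, ‖nv i‖ = 1)
    (h : Fin N → ℝ) (hpos : ∀ i, 0 < h i)
    (K : Set (Es (2 * n)))
    (hK : K = {x | ∀ i, ⟪x, nv i⟫ ≤ h i})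
    (hKcpt : IsCompact K) (h0 : 0 ∈ interior K) :
    combCap omegaT
        (dbl (fun i => (nv i, (0 : Es (2 * n)))) (fun i => ((0 : Es (2 * n)), J (nv i))))
        (dbl h h)
      ≤ 2 * combCap ω₀ nv h := by
  have hskew : ∀ x y : Es (2 * n), ⟪x, J y⟫ = -⟪y, J x⟫ := fun x y => by
    rw [← hJorth x (J y), hJsq, inner_neg_right, real_inner_comm]
  have hself : ∀ x : Es (2 * n), ⟪x, J x⟫ = 0 := fun x => by linarith [hskew x x]
  have hω' : ∀ x y : Es (2 * n), ω₀ x y = -⟪x, J y⟫ := fun x y => by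
    rw [← inner_neg_right, hω, map_neg, hJsq, neg_neg]
  have hcpt : IsCompact {x : Es (2 * n) | ∀ i, ⟪x, nv i⟫ ≤ h i} := hK ▸ hKcpt
  have hne := actionSet_nonempty (by omega) J hJorth ω₀ hω' hskew nv hunit h hpos hcpt
  have hbdd := bddAbove_actionSet omegaT
    (dbl (fun i => (nv i, (0 : Es (2 * n)))) (fun i => ((0 : Es (2 * n)), J (nv i)))) (dbl h h)
    (fun k => by simp only [dbl]; split_ifs <;> exact hpos _)
  have hhalf := fun {Q : ℝ} => half_mem_actionSet_dbl J ω₀ hω' hself hskew nv h (Q := Q)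
  have hbound : ∀ Q ∈ actionSet ω₀ nv h, Q ≤ 2 * sSup (actionSet omegaT
      (dbl (fun i => (nv i, (0 : Es (2 * n)))) (fun i => ((0 : Es (2 * n)), J (nv i))))
      (dbl h h)) := fun Q hQ => by
    linarith [le_csSup hbdd (hhalf hQ)]
  obtain ⟨Q, hQ⟩ := hne
  have hQpos : 0 < Q := by
    obtain ⟨-, -, -, -, -, hQ0, -⟩ := hQ
    exact hQ0
  have hSpos := hQpos.trans_le (le_csSup ⟨_, hbound⟩ hQ)
  have hS := csSup_le ⟨Q, hQ⟩ hbound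
  rw [combCap_eq, combCap_eq]
  have := inv_anti₀ hSpos hS
  rw [mul_inv] at this
  linarith
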